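/- Let G be a finite simple graph with a hole cover C satisfying the NC property. If G has no K_n minor, then Ĝ(C) contains no clique of size n. -/

import Mathlib

open SimpleGraph

variable {V : Type*}

/-- A *hole* of `G`: an induced cycle of length at least 4, given as a closed walk. -/
def IsHole (G : SimpleGraph V) {a : V} (w : G.Walk a a) : Prop :=
  w.IsCycle ∧ 4 ≤ w.length ∧
    ∀ x y : V, x ∈ w.support → y ∈ w.support → G.Adj x y → s(x, y) ∈ w.edges

/-- A graph is *chordal* if it has no hole. -/
def IsChordal (G : SimpleGraph V) : Prop :=
  ∀ (a : V) (w : G.Walk a a), ¬ IsHole G w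

/-- Two edge lists share two consecutive edges. -/
def ShareTwoConsecutiveEdges (l₁ l₂ : List (Sym2 V)) : Prop :=
  ∃ x y z : V, x ≠ z ∧ s(x, y) ∈ l₁ ∧ s(y, z) ∈ l₁ ∧ s(x, y) ∈ l₂ ∧ s(y, z) ∈ l₂

/-- A vertex `u` satisfies the *NC property* in `G`: no hole through `u` and
no hole avoiding `u` share two consecutive edges. -/
def VertexNC (G : SimpleGraph V) (u : V) : Prop :=
  ∀ (a b : V) (w₁ : G.Walk a a) (w₂ : G.Walk b b),
    IsHole G w₁ → IsHole G w₂ → u ∈ w₁.support → u ∉ w₂.support →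
      ¬ ShareTwoConsecutiveEdges w₁.edges w₂.edges

/-- A *hole cover* of `G`: a nonempty vertex set meeting every hole of `G`. -/
def IsHoleCover (G : SimpleGraph V) (C : Set V) : Prop :=
  C.Nonempty ∧ ∀ (a : V) (w : G.Walk a a), IsHole G w → ∃ u ∈ C, u ∈ w.support

/-- A vertex set `C` satisfies the *NC property* in `G`: every vertex of `C`
satisfies the NC property and every hole of `G` contains at most one vertex of `C`. -/
def SetNC (G : SimpleGraph V) (C : Set V) : Prop :=
  (∀ u ∈ C, VertexNC G u) ∧
    ∀ (a : V) (w : G.Walk a a), IsHole G w →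
      ∀ u ∈ C, ∀ v ∈ C, u ∈ w.support → v ∈ w.support → u = v

/-- A graph satisfies the *NC property* if it has a hole cover satisfying the NC property. -/
def HasNCProperty (G : SimpleGraph V) : Prop :=
  ∃ C : Set V, IsHoleCover G C ∧ SetNC G C

/-- A DP-cover of `G` with lists of size `k`, realized on the vertex set `V × Fin k`:
the fibers `{v} × Fin k` are cliques, cross edges exist only over edges of `G`,
and the edges between two fibers form a matching. -/
def IsDPCover (G : SimpleGraph V) (k : ℕ) (H : SimpleGraph (V × Fin k)) : Prop :=
  (∀ (v : V) (i j : Fin k), i ≠ j → H.Adj (v, i) (v, j)) ∧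
  (∀ (u v : V) (i j : Fin k), u ≠ v → H.Adj (u, i) (v, j) → G.Adj u v) ∧
  (∀ (u v : V) (i j j' : Fin k), u ≠ v → H.Adj (u, i) (v, j) → H.Adj (u, i) (v, j') → j = j')

/-- `G` is DP-`k`-colorable: every DP-cover with lists of size `k` admits an
independent transversal. -/
def DPColorable (G : SimpleGraph V) (k : ℕ) : Prop :=
  ∀ H : SimpleGraph (V × Fin k), IsDPCover G k H →
    ∃ f : V → Fin k, ∀ u v : V, ¬ H.Adj (u, f u) (v, f v)

/-- The DP-chromatic number: the least `k` such that `G` is DP-`k`-colorable. -/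
noncomputable def dpChromaticNumber (G : SimpleGraph V) : ℕ :=
  sInf {k | DPColorable G k}

/-- `M` is a minor of `G`, via the branch-set characterization. -/
def HasMinor {W : Type*} (G : SimpleGraph V) (M : SimpleGraph W) : Prop :=
  ∃ B : W → Set V,
    (∀ i, (B i).Nonempty) ∧
    (∀ i, (G.induce (B i)).Connected) ∧
    (Pairwise fun i j => Disjoint (B i) (B j)) ∧
    ∀ i j, M.Adj i j → ∃ a ∈ B i, ∃ b ∈ B j, G.Adj a b

/-- Locally chordalize by `u` all holes of `G` containing `u`: add all edges
joining `u` to the vertices of such holes (new edges go to the vertices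
nonadjacent to `u`). -/
def localChordalize (G : SimpleGraph V) (u : V) : SimpleGraph V :=
  G ⊔ SimpleGraph.fromRel fun x y =>
    x = u ∧ ∃ (a : V) (w : G.Walk a a), IsHole G w ∧ u ∈ w.support ∧ y ∈ w.support

/-- Recursive local chordalizations along a list of vertices. -/
def chordalizeList (G : SimpleGraph V) : List V → SimpleGraph V
  | [] => G
  | u :: l => chordalizeList (localChordalize G u) l

/-- Delete a vertex set (keeping the ambient vertex type: the removed vertices
become isolated). -/
def removeVerts (G : SimpleGraph V) (A : Set V) : SimpleGraph V where
  Adj x y := G.Adj x y ∧ x ∉ A ∧ y ∉ A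
  symm := ⟨by intro x y h; exact ⟨h.1.symm, h.2.2, h.2.1⟩⟩
  loopless := ⟨by intro x h; exact G.loopless.irrefl x h.1⟩

/-- The chordalization chain corresponding to an ordered partition
`parts 0, …, parts (k-1)` (playing the role of `C₁, …, C_k`) of a hole cover:
`(lcChain G parts i).1 = Gᵢ` and `(lcChain G parts i).2 = Gᵢ*`. -/
def lcChain (G : SimpleGraph V) {k : ℕ} (parts : Fin k → List V) :
    ℕ → SimpleGraph V × SimpleGraph V
  | 0 =>
      (removeVerts G {v | ∃ i, v ∈ parts i}, removeVerts G {v | ∃ i, v ∈ parts i})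
  | i + 1 =>
      let Gi := (lcChain G parts i).2 ⊔
        removeVerts G {v | ∃ j : Fin k, i + 1 ≤ (j : ℕ) ∧ v ∈ parts j}
      (Gi, if h : i < k then chordalizeList Gi (parts ⟨i, h⟩) else Gi)

/-- `(parts 0, …, parts (k-1))` is a *local chordalization partition* of the hole
cover `C` of `G`. -/
def IsLCPartition (G : SimpleGraph V) (C : Set V) {k : ℕ} (parts : Fin k → List V) : Prop :=
  (∀ i, (parts i).Nodup) ∧
  (∀ i, parts i ≠ []) ∧
  (Pairwise fun i j : Fin k => ∀ v, v ∈ parts i → v ∉ parts j) ∧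
  {v | ∃ i, v ∈ parts i} = C ∧
  ∀ i : Fin k,
    IsHoleCover (lcChain G parts ((i : ℕ) + 1)).1 {v | v ∈ parts i} ∧
    SetNC (lcChain G parts ((i : ℕ) + 1)).1 {v | v ∈ parts i} ∧
    IsChordal (lcChain G parts ((i : ℕ) + 1)).2

/-- The *non-chordality index* of `G`. -/
noncomputable def ncIndex (G : SimpleGraph V) : ℕ := by
  classical exact
    if IsChordal G then 0
    else sInf {k | ∃ (C : Set V) (parts : Fin k → List V),
      IsHoleCover G C ∧ IsLCPartition G C parts}

/-- `G` is `k`-list-colorable. -/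
def ListColorable (G : SimpleGraph V) (k : ℕ) : Prop :=
  ∀ L : V → Finset ℕ, (∀ v, k ≤ (L v).card) →
    ∃ f : V → ℕ, (∀ v, f v ∈ L v) ∧ ∀ u v : V, G.Adj u v → f u ≠ f v

/-- The list chromatic number of `G`. -/
noncomputable def listChromaticNumber (G : SimpleGraph V) : ℕ :=
  sInf {k | ListColorable G k}


/-- `a` and `b` are joined by a walk inside `S`. -/
def ConnIn (G : SimpleGraph V) (S : Set V) (a b : V) : Prop :=
  ∃ p : G.Walk a b, ∀ v ∈ p.support, v ∈ S

lemma ConnIn.refl {G : SimpleGraph V} {S : Set V} {a : V} (h : a ∈ S) : ConnIn G S a a :=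
  ⟨.nil, by simpa using h⟩

lemma ConnIn.symm {G : SimpleGraph V} {S : Set V} {a b : V} (h : ConnIn G S a b) :
    ConnIn G S b a := by
  obtain ⟨p, hp⟩ := h
  exact ⟨p.reverse, by simpa using hp⟩

lemma ConnIn.trans {G : SimpleGraph V} {S : Set V} {a b c : V} (h : ConnIn G S a b)
    (h' : ConnIn G S b c) : ConnIn G S a c := by
  obtain ⟨p, hp⟩ := h
  obtain ⟨q, hq⟩ := h'
  refine ⟨p.append q, fun v hv => ?_⟩
  rcases (Walk.mem_support_append_iff _ _).1 hv with h | h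
  · exact hp v h
  · exact hq v h

lemma ConnIn.mono {G : SimpleGraph V} {S T : Set V} {a b : V} (h : ConnIn G S a b)
    (hST : S ⊆ T) : ConnIn G T a b := by
  obtain ⟨p, hp⟩ := h
  exact ⟨p, fun v hv => hST (hp v hv)⟩

lemma ConnIn.adj {G : SimpleGraph V} {S : Set V} {a b : V} (ha : a ∈ S) (hb : b ∈ S)
    (h : G.Adj a b) : ConnIn G S a b :=
  ⟨.cons h .nil, by simp [ha, hb]⟩

lemma ConnIn.right {G : SimpleGraph V} {S : Set V} {a b : V} (h : ConnIn G S a b) : b ∈ S := by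
  obtain ⟨p, hp⟩ := h
  exact hp _ p.end_mem_support

lemma mem_edges_getVert {G : SimpleGraph V} {a b : V} (p : G.Walk a b) (e : Sym2 V) :
    e ∈ p.edges ↔ ∃ i, i < p.length ∧ e = s(p.getVert i, p.getVert (i + 1)) := by
  induction p with
  | nil => simp
  | cons h p ih =>
    rw [Walk.edges_cons, List.mem_cons, ih]
    constructor
    · rintro (rfl | ⟨i, hi, rfl⟩)
      · exact ⟨0, by simp, by simp⟩
      · exact ⟨i + 1, by simpa using hi, by simp⟩
    · rintro ⟨i, hi, rfl⟩
      rcases i with _ | i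
      · left; simp
      · right; exact ⟨i, by simpa using hi, by simp⟩

lemma getVert_edge {G : SimpleGraph V} {a b : V} (p : G.Walk a b) {i : ℕ} (hi : i < p.length) :
    s(p.getVert i, p.getVert (i + 1)) ∈ p.edges :=
  (mem_edges_getVert p _).2 ⟨i, hi, rfl⟩

/-- A shortest walk inside `S` is an induced path. -/
lemma exists_induced {G : SimpleGraph V} {S : Set V} {s t : V} (h : ConnIn G S s t) :
    ∃ p : G.Walk s t, p.IsPath ∧ (∀ v ∈ p.support, v ∈ S) ∧
      ∀ x y : V, x ∈ p.support → y ∈ p.support → G.Adj x y → s(x, y) ∈ p.edges := by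
  classical
  let P : ℕ → Prop := fun n => ∃ p : G.Walk s t, p.length = n ∧ ∀ v ∈ p.support, v ∈ S
  have hP : ∃ n, P n := by
    obtain ⟨p, hp⟩ := h
    exact ⟨_, p, rfl, hp⟩
  obtain ⟨p, hpl, hp, hpath'⟩ : ∃ p : G.Walk s t, p.length ≤ Nat.find hP ∧
      (∀ v ∈ p.support, v ∈ S) ∧ p.IsPath := by
    obtain ⟨p, hpl, hp⟩ := Nat.find_spec hP
    exact ⟨p.bypass, by rw [← hpl]; exact p.length_bypass_le_length,
      fun v hv => hp v (p.support_bypass_subset_support hv), p.bypass_isPath⟩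
  have hmin : ∀ q : G.Walk s t, (∀ v ∈ q.support, v ∈ S) → p.length ≤ q.length := by
    intro q hq
    exact hpl.trans (Nat.find_min' hP ⟨q, rfl, hq⟩)
  have key : ∀ i j, i < j → j ≤ p.length → G.Adj (p.getVert i) (p.getVert j) → j = i + 1 := by
    intro i j hij hj hadj
    have := hmin ((p.take i).append (.cons hadj (p.drop j))) (by
      intro v hv
      rw [Walk.mem_support_append_iff, Walk.support_cons, List.mem_cons] at hv
      rcases hv with hv | rfl | hv
      · obtain ⟨k, hk, -⟩ := Walk.mem_support_iff_exists_getVert.1 hv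
        exact hp v ((p.isSubwalk_take i).support_subset hv)
      · exact hp _ (p.getVert_mem_support i)
      · exact hp v ((p.isSubwalk_drop j).support_subset hv))
    rw [Walk.length_append, Walk.length_cons, Walk.take_length, Walk.drop_length] at this
    omega
  refine ⟨p, hpath', hp, ?_⟩
  intro x y hx hy hxy
  obtain ⟨i, rfl, hi⟩ := Walk.mem_support_iff_exists_getVert.1 hx
  obtain ⟨j, rfl, hj⟩ := Walk.mem_support_iff_exists_getVert.1 hy
  rcases lt_trichotomy i j with h | h | h
  · have := key i j h hj hxy
    subst this
    exact getVert_edge p (by omega)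
  · subst h; exact absurd hxy (G.loopless.irrefl _)
  · have := key j i h hi hxy.symm
    subst this
    rw [Sym2.eq_swap]
    exact getVert_edge p (by omega)

/-- Closing up a shortest path through `u` gives a hole. -/
lemma hole_maker {G : SimpleGraph V} {S : Set V} {u s t : V} (hus : G.Adj u s) (hut : G.Adj u t)
    (hst : s ≠ t) (hnst : ¬ G.Adj s t) (huS : u ∉ S)
    (hS : ∀ v ∈ S, G.Adj u v → v = s ∨ v = t) (hc : ConnIn G S s t) :
    ∃ w : G.Walk u u, IsHole G w ∧ s(u, s) ∈ w.edges ∧ s(u, t) ∈ w.edges ∧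
      (∀ v ∈ w.support, v = u ∨ v ∈ S) ∧ ConnIn G (S ∩ {v | v ∈ w.support}) s t := by
  obtain ⟨p, hp, hpS, hind⟩ := exists_induced hc
  have hup : u ∉ p.support := fun h => huS (hpS u h)
  have hsupp : ∀ v, v ∈ (Walk.cons hus (p.concat hut.symm)).support ↔ v = u ∨ v ∈ p.support := by
    intro v
    rw [Walk.support_cons, Walk.support_concat]
    simp
    tauto
  have hedge : ∀ e, e ∈ (Walk.cons hus (p.concat hut.symm)).edges ↔
      e = s(u, s) ∨ e ∈ p.edges ∨ e = s(u, t) := by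
    intro e
    rw [Walk.edges_cons, Walk.edges_concat]
    simp [Sym2.eq_swap]
  refine ⟨.cons hus (p.concat hut.symm), ⟨?_, ?_, ?_⟩, ?_, ?_, ?_, ?_⟩
  · rw [Walk.cons_isCycle_iff]
    refine ⟨hp.concat hup _, ?_⟩
    rw [Walk.edges_concat, List.concat_eq_append, List.mem_append]
    rintro (h | h)
    · exact hup (p.fst_mem_support_of_mem_edges h)
    · simp at h
      rcases h with h | h
      · exact hut.ne h.1
      · exact hst h
  · rw [Walk.length_cons, Walk.length_concat]
    have h0 : p.length ≠ 0 := fun h => hst (Walk.eq_of_length_eq_zero h)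
    have h1 : p.length ≠ 1 := fun h => hnst (Walk.adj_of_length_eq_one h)
    omega
  · intro x y hx hy hxy
    rw [hsupp] at hx hy
    rw [hedge]
    rcases hx with rfl | hx
    · rcases hy with rfl | hy
      · exact absurd hxy (G.loopless.irrefl _)
      · rcases hS y (hpS y hy) hxy with rfl | rfl <;> simp
    · rcases hy with rfl | hy
      · rcases hS x (hpS x hx) hxy.symm with rfl | rfl <;> simp [Sym2.eq_swap]
      · exact Or.inr (Or.inl (hind x y hx hy hxy))
  · rw [hedge]; simp
  · rw [hedge]; simp
  · intro v hv
    rw [hsupp] at hv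
    rcases hv with h | h
    · exact Or.inl h
    · exact Or.inr (hpS v h)
  · exact ⟨p, fun v hv => ⟨hpS v hv, (hsupp v).2 (Or.inr hv)⟩⟩

/-- `u, x 1, ..., x m` is an induced cycle of length at least four. -/
structure HRep (G : SimpleGraph V) (u : V) (m : ℕ) (x : ℕ → V) : Prop where
  hm : 3 ≤ m
  inj : ∀ i j, 1 ≤ i → i ≤ m → 1 ≤ j → j ≤ m → x i = x j → i = j
  ne : ∀ i, 1 ≤ i → i ≤ m → x i ≠ u
  adj : ∀ i j, 1 ≤ i → i ≤ m → 1 ≤ j → j ≤ m → (G.Adj (x i) (x j) ↔ (i + 1 = j ∨ j + 1 = i))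
  adju : ∀ i, 1 ≤ i → i ≤ m → (G.Adj u (x i) ↔ (i = 1 ∨ i = m))

lemma exists_rep {G : SimpleGraph V} {a u : V} {w : G.Walk a a} (hw : IsHole G w)
    (hu : u ∈ w.support) :
    ∃ (m : ℕ) (x : ℕ → V), HRep G u m x ∧
      (∀ v, v ∈ w.support ↔ v = u ∨ ∃ i, 1 ≤ i ∧ i ≤ m ∧ v = x i) ∧
      ∀ i, 1 ≤ i → i < m → s(x i, x (i + 1)) ∈ w.edges := by
  classical
  obtain ⟨hc, h4, hind⟩ := hw
  set c := w.rotate u hu with hcdef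
  have hcc : c.IsCycle := (Walk.isCycle_rotate hu).2 hc
  have hlen : c.length = w.length := Walk.length_rotate _ _ _
  have hsup : ∀ v, v ∈ c.support ↔ v ∈ w.support := fun v => Walk.mem_support_rotate_iff _ _ _
  have hed : ∀ e, e ∈ c.edges ↔ e ∈ w.edges := fun e => (Walk.rotate_edges _ _ _).mem_iff
  have hinj := hcc.getVert_injOn'
  have h0 : c.getVert 0 = u := by simp
  have hn : c.getVert c.length = u := by simp
  have inj : ∀ i j, i < c.length → j < c.length → c.getVert i = c.getVert j → i = j := by
    intro i j hi hj hij
    exact hinj (by simp; omega) (by simp; omega) hij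
  have hadj : ∀ i j, i < c.length → j < c.length → G.Adj (c.getVert i) (c.getVert j) →
      i + 1 = j ∨ j + 1 = i ∨ (i = 0 ∧ j + 1 = c.length) ∨ (j = 0 ∧ i + 1 = c.length) := by
    intro i j hi hj hij
    have := hind _ _ ((hsup _).1 (c.getVert_mem_support i)) ((hsup _).1 (c.getVert_mem_support j)) hij
    rw [← hed, mem_edges_getVert] at this
    obtain ⟨k, hk, hk'⟩ := this
    have hk1 : c.getVert (k + 1) = c.getVert (if k + 1 = c.length then 0 else k + 1) := by
      split_ifs with h
      · rw [h, hn, h0]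
      · rfl
    rw [hk1] at hk'
    have hlt : (if k + 1 = c.length then 0 else k + 1) < c.length := by split_ifs <;> omega
    rw [Sym2.eq_iff] at hk'
    rcases hk' with ⟨e1, e2⟩ | ⟨e1, e2⟩
    · have := inj _ _ hi hk e1
      have := inj _ _ hj hlt e2
      split_ifs at this <;> omega
    · have := inj _ _ hi hlt e1
      have := inj _ _ hj hk e2
      split_ifs at * <;> omega
  refine ⟨c.length - 1, c.getVert, ⟨by omega, ?_, ?_, ?_, ?_⟩, ?_, ?_⟩
  · intro i j _ h1 _ h2 h
    exact inj i j (by omega) (by omega) h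
  · intro i h1 h2 h
    have := inj i 0 (by omega) (by omega) (h.trans h0.symm)
    omega
  · intro i j hi hi' hj hj'
    constructor
    · intro h
      have := hadj i j (by omega) (by omega) h
      omega
    · rintro (rfl | rfl)
      · exact c.adj_getVert_succ (by omega)
      · exact (c.adj_getVert_succ (by omega)).symm
  · intro i hi hi'
    constructor
    · intro h
      have := hadj 0 i (by omega) (by omega) (by rw [h0]; exact h)
      omega
    · rintro (rfl | rfl)
      · have := c.adj_getVert_succ (i := 0) (by omega)
        rwa [h0] at this
      · have := c.adj_getVert_succ (i := c.length - 1) (by omega)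
        rw [Nat.sub_add_cancel (by omega), hn] at this
        exact this.symm
  · intro v
    rw [← hsup, Walk.mem_support_iff_exists_getVert]
    constructor
    · rintro ⟨k, rfl, hk⟩
      by_cases hk0 : k = 0
      · left; rw [hk0, h0]
      by_cases hk1 : k = c.length
      · left; rw [hk1, hn]
      · right; exact ⟨k, by omega, by omega, rfl⟩
    · rintro (rfl | ⟨k, h1, h2, rfl⟩)
      · exact ⟨0, h0, by omega⟩
      · exact ⟨k, rfl, by omega⟩
  · intro i h1 h2
    rw [← hed]
    exact getVert_edge c (by omega)

/-- Any two vertices of `D` are joined by a walk inside `D`. -/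
def ConnSet (G : SimpleGraph V) (D : Set V) : Prop := ∀ a ∈ D, ∀ b ∈ D, ConnIn G D a b

/-- `v` lies in the closed neighbourhood of `D`. -/
def Touch (G : SimpleGraph V) (D : Set V) (v : V) : Prop := v ∈ D ∨ ∃ d ∈ D, G.Adj d v

lemma connSet_singleton (G : SimpleGraph V) (v : V) : ConnSet G {v} := by
  rintro a rfl b rfl
  exact ConnIn.refl rfl

lemma touch_conn {G : SimpleGraph V} {D S : Set V} {v : V} (h : Touch G D v) (hD : D ⊆ S)
    (hv : v ∈ S) : ∃ d ∈ D, ConnIn G S v d := by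
  rcases h with h | ⟨d, hd, h⟩
  · exact ⟨v, h, ConnIn.refl hv⟩
  · exact ⟨d, hd, ConnIn.adj hv (hD hd) h.symm⟩

lemma seg_conn {G : SimpleGraph V} {x : ℕ → V} {S : Set V} {a b : ℕ} (hab : a ≤ b)
    (hadj : ∀ i, a ≤ i → i < b → G.Adj (x i) (x (i + 1)))
    (hS : ∀ i, a ≤ i → i ≤ b → x i ∈ S) : ConnIn G S (x a) (x b) := by
  induction b, hab using Nat.le_induction with
  | base => exact ConnIn.refl (hS a le_rfl le_rfl)
  | succ b hb ih =>
    exact (ih (fun i h1 h2 => hadj i h1 (by omega)) (fun i h1 h2 => hS i h1 (by omega))).trans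
      (ConnIn.adj (hS _ hb (by omega)) (hS _ (by omega) le_rfl) (hadj b hb (by omega)))

/-- The vertices `x a, ..., x b`. -/
def seg (x : ℕ → V) (a b : ℕ) : Set V := {v | ∃ i, a ≤ i ∧ i ≤ b ∧ v = x i}

lemma seg_connSet {G : SimpleGraph V} {x : ℕ → V} {a b : ℕ}
    (hadj : ∀ i, a ≤ i → i < b → G.Adj (x i) (x (i + 1))) : ConnSet G (seg x a b) := by
  rintro _ ⟨i, hi, hi', rfl⟩ _ ⟨j, hj, hj', rfl⟩
  rcases le_total i j with h | h
  · exact seg_conn h (fun k h1 h2 => hadj k (by omega) (by omega))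
      (fun k h1 h2 => ⟨k, by omega, by omega, rfl⟩)
  · exact (seg_conn (S := seg x a b) h (fun k h1 h2 => hadj k (by omega) (by omega))
      (fun k h1 h2 => ⟨k, by omega, by omega, rfl⟩)).symm

/-- Under the NC property, the closed neighbourhood of a connected set avoiding `u` meets a hole
through `u`, minus `u`, in an interval. -/
lemma star {G : SimpleGraph V} {u : V} (hNC : VertexNC G u) {a₀ : V} {w : G.Walk a₀ a₀}
    (hw : IsHole G w) (hu : u ∈ w.support) {m : ℕ} {x : ℕ → V} (H : HRep G u m x)
    (hedge : ∀ i, 1 ≤ i → i < m → s(x i, x (i + 1)) ∈ w.edges)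
    {D : Set V} (hD : ConnSet G D) (huD : u ∉ D) {i c k : ℕ} (hi : 1 ≤ i) (hic : i < c)
    (hck : c < k) (hk : k ≤ m) (hti : Touch G D (x i)) (htk : Touch G D (x k)) :
    Touch G D (x c) := by
  by_contra hc
  obtain ⟨a, hia, hac, hta, hna⟩ : ∃ a, i ≤ a ∧ a < c ∧ Touch G D (x a) ∧
      ¬ Touch G D (x (a + 1)) := by
    by_contra hcon
    push Not at hcon
    have : ∀ j, i ≤ j → j ≤ c → Touch G D (x j) := by
      intro j hj
      induction j, hj using Nat.le_induction with
      | base => intro _; exact hti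
      | succ j hj ih => intro h; exact hcon j hj (by omega) (ih (by omega))
    exact hc (this c hic.le le_rfl)
  have hadj : ∀ j, 1 ≤ j → j < m → G.Adj (x j) (x (j + 1)) := fun j h1 h2 =>
    (H.adj j (j + 1) h1 h2.le (by omega) (by omega)).2 (Or.inl rfl)
  let S : Set V := D ∪ {x a} ∪ seg x (a + 2) k
  have hDS : D ⊆ S := fun v hv => Or.inl (Or.inl hv)
  have hxa : x a ∈ S := Or.inl (Or.inr rfl)
  have hxk : x k ∈ S := Or.inr ⟨k, by omega, le_rfl, rfl⟩
  obtain ⟨w', hw', he1, he2, hsup, -⟩ := hole_maker (G := G) (S := S) (u := x (a + 1)) (s := x a)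
    (t := x (a + 2)) (hadj a (by omega) (by omega)).symm (hadj (a + 1) (by omega) (by omega))
    (fun h => by have := H.inj _ _ (by omega) (by omega) (by omega) (by omega) h; omega)
    (fun h => by
      have := (H.adj _ _ (by omega) (by omega) (by omega) (by omega)).1 h
      omega)
    (by
      rintro ((h | h) | ⟨j, h1, h2, h⟩)
      · exact hna (Or.inl h)
      · have := H.inj _ _ (by omega) (by omega) (by omega) (by omega) h; omega
      · have := H.inj _ _ (by omega) (by omega) (by omega) (by omega) h; omega)
    (by
      rintro v ((h | h) | ⟨j, h1, h2, rfl⟩) hv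
      · exact (hna (Or.inr ⟨v, h, hv.symm⟩)).elim
      · exact Or.inl h
      · have := (H.adj _ _ (by omega) (by omega) (by omega) (by omega)).1 hv
        have : j = a + 2 := by omega
        subst this; exact Or.inr rfl)
    (by
      obtain ⟨d, hd, h1⟩ := touch_conn hta hDS hxa
      obtain ⟨e, he, h2⟩ := touch_conn htk hDS hxk
      have h3 : ConnIn G S (x (a + 2)) (x k) := seg_conn (by omega)
        (fun j h1 h2 => hadj j (by omega) (by omega)) (fun j h1 h2 => Or.inr ⟨j, h1, h2, rfl⟩)
      exact h1.trans (((hD d hd e he).mono hDS).trans (h2.symm.trans h3.symm)))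
  refine hNC _ _ w w' hw hw' hu ?_ ⟨x a, x (a + 1), x (a + 2), ?_, hedge a (by omega) (by omega),
    hedge (a + 1) (by omega) (by omega), ?_, he2⟩
  · intro h
    rcases hsup u h with h | (h | h) | ⟨j, h1, h2, h⟩
    · exact H.ne _ (by omega) (by omega) h.symm
    · exact huD h
    · exact H.ne _ (by omega) (by omega) h.symm
    · exact H.ne _ (by omega) (by omega) h.symm
  · intro h
    have := H.inj _ _ (by omega) (by omega) (by omega) (by omega) h; omega
  · rw [Sym2.eq_swap]; exact he1

/-- Some hole of `G` contains both `u` and `x`. -/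
def Hol (G : SimpleGraph V) (u x : V) : Prop :=
  ∃ (a : V) (w : G.Walk a a), IsHole G w ∧ u ∈ w.support ∧ x ∈ w.support

lemma access {G : SimpleGraph V} {u : V} (hNC : VertexNC G u) {x : V} (hxu : x ≠ u)
    (hacc : G.Adj u x ∨ Hol G u x) {D : Set V} (hD : ConnSet G D) (huD : u ∉ D)
    (hDx : ¬ Touch G D x) :
    ∃ (X : Set V) (s : V), ConnSet G X ∧ x ∈ X ∧ s ∈ X ∧ G.Adj u s ∧ u ∉ X ∧
      (∀ v ∈ X, G.Adj u v → v = s) ∧ ∀ v ∈ X, ¬ Touch G D v := by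
  by_cases hadj : G.Adj u x
  · refine ⟨{x}, x, connSet_singleton G x, rfl, rfl, hadj, fun h => hxu h.symm, ?_, ?_⟩
    · rintro v rfl _; rfl
    · rintro v rfl; exact hDx
  obtain ⟨a, w, hw, hu, hx⟩ := hacc.resolve_left hadj
  obtain ⟨m, y, H, hsup, hedge⟩ := exists_rep hw hu
  obtain ⟨i, hi1, him, rfl⟩ := ((hsup x).1 hx).resolve_left hxu
  have hne : ¬ (i = 1 ∨ i = m) := fun h => hadj ((H.adju i hi1 him).2 h)
  have hcon : ∀ j, 1 ≤ j → j < m → G.Adj (y j) (y (j + 1)) := fun j h1 h2 =>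
    (H.adj j (j + 1) h1 h2.le (by omega) (by omega)).2 (Or.inl rfl)
  have hm := H.hm
  by_cases hleft : ∀ j, 1 ≤ j → j ≤ i → ¬ Touch G D (y j)
  · refine ⟨seg y 1 i, y 1, seg_connSet fun j h1 h2 => hcon j (by omega) (by omega),
      ⟨i, hi1, le_rfl, rfl⟩, ⟨1, le_rfl, hi1, rfl⟩, (H.adju 1 (by omega) (by omega)).2 (Or.inl rfl),
      ?_, ?_, ?_⟩
    · rintro ⟨j, h1, h2, h⟩
      exact H.ne j (by omega) (by omega) h.symm
    · rintro _ ⟨j, h1, h2, rfl⟩ h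
      have := (H.adju j (by omega) (by omega)).1 h
      have : j = 1 := by omega
      rw [this]
    · rintro _ ⟨j, h1, h2, rfl⟩
      exact hleft j h1 h2
  · push Not at hleft
    obtain ⟨j, hj1, hji, htj⟩ := hleft
    have hji' : j ≠ i := by rintro rfl; exact hDx htj
    refine ⟨seg y i m, y m, seg_connSet fun j h1 h2 => hcon j (by omega) (by omega),
      ⟨i, le_rfl, him, rfl⟩, ⟨m, him, le_rfl, rfl⟩, (H.adju m (by omega) (by omega)).2 (Or.inr rfl),
      ?_, ?_, ?_⟩
    · rintro ⟨j, h1, h2, h⟩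
      exact H.ne j (by omega) (by omega) h.symm
    · rintro _ ⟨j, h1, h2, rfl⟩ h
      have := (H.adju j (by omega) (by omega)).1 h
      have : j = m := by omega
      rw [this]
    · rintro _ ⟨k, h1, h2, rfl⟩ htk
      have hki : k ≠ i := by rintro rfl; exact hDx htk
      exact hDx (star hNC hw hu H hedge hD huD hj1 (by omega) (by omega : i < k) h2 htj htk)

lemma crossing {G : SimpleGraph V} {S X : Set V} {s t : V} (h : ConnIn G S s t) (hs : s ∈ X)
    (ht : t ∉ X) : ∃ a b, a ∈ X ∧ b ∉ X ∧ b ∈ S ∧ G.Adj a b := by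
  obtain ⟨p, hp⟩ := h
  obtain ⟨d, hd, h1, h2⟩ := p.exists_boundary_dart X hs ht
  exact ⟨d.fst, d.snd, h1, h2, hp _ (p.dart_snd_mem_support_of_mem_darts hd), d.adj⟩

lemma main_hole {G : SimpleGraph V} {u : V} (hNC : VertexNC G u) {x y : V} (hxu : x ≠ u)
    (hyu : y ≠ u) (hxy : x ≠ y) (hnxy : ¬ G.Adj x y) (hx : G.Adj u x ∨ Hol G u x)
    (hy : G.Adj u y ∨ Hol G u y) {D : Set V} (hD : ConnSet G D) (huD : u ∉ D)
    (hDu : ∀ d ∈ D, ¬ G.Adj u d) (hDx : ∃ d ∈ D, G.Adj x d) (hDy : ∃ d ∈ D, G.Adj y d) :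
    ∃ d ∈ D, Hol G u d := by
  obtain ⟨X, s, hX, hxX, hsX, hus, huX, hXu, hXy⟩ := access hNC hxu hx (connSet_singleton G y)
    (fun h => hyu h.symm) (by
      rintro (h | ⟨d, rfl, h⟩)
      · exact hxy h
      · exact hnxy h.symm)
  obtain ⟨Y, t, hY, hyY, htY, hut, huY, hYu, hYX⟩ := access hNC hyu hy hX huX (by
      rintro (h | ⟨d, hd, h⟩)
      · exact hXy y h (Or.inl rfl)
      · exact hXy d hd (Or.inr ⟨y, rfl, h.symm⟩))
  obtain ⟨dx, hdx, hdx'⟩ := hDx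
  obtain ⟨dy, hdy, hdy'⟩ := hDy
  let S : Set V := X ∪ Y ∪ D
  have hXS : X ⊆ S := fun v hv => Or.inl (Or.inl hv)
  have hYS : Y ⊆ S := fun v hv => Or.inl (Or.inr hv)
  have hDS : D ⊆ S := fun v hv => Or.inr hv
  obtain ⟨w, hw, he1, -, -, hc⟩ := hole_maker (S := S) hus hut
    (fun h => hYX t htY (Or.inl (h ▸ hsX))) (fun h => hYX t htY (Or.inr ⟨s, hsX, h⟩))
    (by
      rintro ((h | h) | h)
      · exact huX h
      · exact huY h
      · exact huD h)
    (by
      rintro v ((h | h) | h) hv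
      · exact Or.inl (hXu v h hv)
      · exact Or.inr (hYu v h hv)
      · exact absurd hv (hDu v h))
    (((hX s hsX x hxX).mono hXS).trans <| (ConnIn.adj (hXS hxX) (hDS hdx) hdx').trans <|
      ((hD dx hdx dy hdy).mono hDS).trans <| (ConnIn.adj (hDS hdy) (hYS hyY) hdy'.symm).trans <|
      (hY y hyY t htY).mono hYS)
  obtain ⟨a, b, ha, hb, ⟨hbS, hbw⟩, hab⟩ := crossing hc hsX (fun h => hYX t htY (Or.inl h))
  rcases hbS with (h | h) | h
  · exact absurd h hb
  · exact absurd (Or.inr ⟨a, ha, hab⟩) (hYX b h)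
  · exact ⟨b, h, _, w, hw, w.start_mem_support, hbw⟩

lemma two_hole {G : SimpleGraph V} {a b x : V} (ha : VertexNC G a) (hb : VertexNC G b)
    (hab : G.Adj a b) (hxa : x ≠ a) (hxb : x ≠ b) (hnax : ¬ G.Adj a x) (hnbx : ¬ G.Adj b x)
    (hax : Hol G a x) (hbx : Hol G b x) : Hol G a b := by
  obtain ⟨X, s, hX, hxX, hsX, hus, huX, hXu, hXb⟩ := access ha hxa (Or.inr hax)
    (connSet_singleton G b) (fun h => hab.ne h) (by
      rintro (h | ⟨d, rfl, h⟩)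
      · exact hxb h
      · exact hnbx h)
  obtain ⟨Y, t, hY, hxY, htY, hut, huY, hYu, hYa⟩ := access hb hxb (Or.inr hbx)
    (connSet_singleton G a) (fun h => hab.ne h.symm) (by
      rintro (h | ⟨d, rfl, h⟩)
      · exact hxa h
      · exact hnax h)
  let S : Set V := X ∪ Y ∪ {b}
  have hXS : X ⊆ S := fun v hv => Or.inl (Or.inl hv)
  have hYS : Y ⊆ S := fun v hv => Or.inl (Or.inr hv)
  obtain ⟨w, hw, -, he, -, -⟩ := hole_maker (S := S) hus hab
    (fun h => hXb s hsX (Or.inl h)) (fun h => hXb s hsX (Or.inr ⟨b, rfl, h.symm⟩))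
    (by
      rintro ((h | h) | h)
      · exact huX h
      · exact hYa a h (Or.inl rfl)
      · exact hab.ne h)
    (by
      rintro v ((h | h) | h) hv
      · exact Or.inl (hXu v h hv)
      · exact absurd (Or.inr ⟨a, rfl, hv⟩) (hYa v h)
      · exact Or.inr h)
    (((hX s hsX x hxX).mono hXS).trans <| ((hY x hxY t htY).mono hYS).trans <|
      ConnIn.adj (hYS htY) (Or.inr rfl) hut.symm)
  exact ⟨_, w, hw, w.start_mem_support, w.snd_mem_support_of_mem_edges he⟩

lemma lc_adj {G : SimpleGraph V} {u x y : V} :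
    (localChordalize G u).Adj x y ↔
      G.Adj x y ∨ (x ≠ y ∧ ((x = u ∧ Hol G u y) ∨ (y = u ∧ Hol G u x))) := by
  simp only [localChordalize, SimpleGraph.sup_adj, SimpleGraph.fromRel_adj, Hol]

lemma lc_hole {G : SimpleGraph V} {u : V} (hNC : VertexNC G u) {a : V}
    {w' : (localChordalize G u).Walk a a} (hw' : IsHole (localChordalize G u) w') :
    ∃ w : G.Walk a a, IsHole G w ∧ w.support = w'.support ∧ w.edges = w'.edges := by
  by_cases hu : u ∈ w'.support
  · exfalso
    obtain ⟨m, x, H, -, -⟩ := exists_rep hw' hu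
    have hm := H.hm
    have hacc : ∀ v, (localChordalize G u).Adj u v → G.Adj u v ∨ Hol G u v := by
      intro v h
      rcases lc_adj.1 h with h | ⟨h, ⟨-, h'⟩ | ⟨h', -⟩⟩
      · exact Or.inl h
      · exact Or.inr h'
      · exact absurd h'.symm h
    have hconv : ∀ v, v ≠ u → (G.Adj u v ∨ Hol G u v) → (localChordalize G u).Adj u v := by
      intro v hv h
      rw [lc_adj]
      rcases h with h | h
      · exact Or.inl h
      · exact Or.inr ⟨hv.symm, Or.inl ⟨rfl, h⟩⟩
    have hadj : ∀ j, 1 ≤ j → j < m → G.Adj (x j) (x (j + 1)) := by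
      intro j h1 h2
      rcases lc_adj.1 ((H.adj j (j + 1) h1 h2.le (by omega) (by omega)).2 (Or.inl rfl)) with
        h | ⟨-, ⟨h, -⟩ | ⟨h, -⟩⟩
      · exact h
      · exact absurd h (H.ne _ (by omega) (by omega))
      · exact absurd h (H.ne _ (by omega) (by omega))
    have hno : ∀ j, 2 ≤ j → j ≤ m - 1 → ¬ (G.Adj u (x j) ∨ Hol G u (x j)) := by
      intro j h1 h2 h
      have := (H.adju j (by omega) (by omega)).1
        (hconv _ (H.ne _ (by omega) (by omega)) h)
      omega
    obtain ⟨d, ⟨j, h1, h2, rfl⟩, hd⟩ := main_hole hNC (x := x 1) (y := x m) (D := seg x 2 (m - 1))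
      (H.ne _ (by omega) (by omega)) (H.ne _ (by omega) (by omega))
      (fun h => by have := H.inj _ _ (by omega) (by omega) (by omega) (by omega) h; omega)
      (fun h => by
        have := (H.adj _ _ (by omega) (by omega) (by omega) (by omega)).1
          (lc_adj.2 (Or.inl h) : (localChordalize G u).Adj _ _)
        omega)
      (hacc _ ((H.adju _ (by omega) (by omega)).2 (Or.inl rfl)))
      (hacc _ ((H.adju _ (by omega) (by omega)).2 (Or.inr rfl)))
      (seg_connSet fun j h1 h2 => hadj j (by omega) (by omega))
      (by
        rintro ⟨j, h1, h2, h⟩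
        exact H.ne j (by omega) (by omega) h.symm)
      (by
        rintro _ ⟨j, h1, h2, rfl⟩ h
        exact hno j h1 h2 (Or.inl h))
      ⟨x 2, ⟨2, le_rfl, by omega, rfl⟩, hadj 1 le_rfl (by omega)⟩
      ⟨x (m - 1), ⟨m - 1, by omega, le_rfl, rfl⟩, by
        have := hadj (m - 1) (by omega) (by omega)
        rw [Nat.sub_add_cancel (by omega)] at this
        exact this.symm⟩
    exact hno j h1 h2 (Or.inr hd)
  · have hG : ∀ e ∈ w'.edges, e ∈ G.edgeSet := by
      intro e he
      induction e using Sym2.ind with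
      | _ x y =>
        have hx := w'.fst_mem_support_of_mem_edges he
        have hy := w'.snd_mem_support_of_mem_edges he
        rcases lc_adj.1 (w'.adj_of_mem_edges he) with h | ⟨-, ⟨rfl, -⟩ | ⟨rfl, -⟩⟩
        · exact h
        · exact absurd hx hu
        · exact absurd hy hu
    refine ⟨w'.transfer G hG, ⟨hw'.1.transfer hG, ?_, ?_⟩, Walk.support_transfer _ _,
      Walk.edges_transfer _ _⟩
    · rw [Walk.length_transfer]; exact hw'.2.1
    · intro x y hx hy hxy
      rw [Walk.support_transfer] at hx hy
      rw [Walk.edges_transfer]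
      exact hw'.2.2 x y hx hy (lc_adj.2 (Or.inl hxy))

lemma lc_setNC {G : SimpleGraph V} {C : Set V} (hC : SetNC G C) {u : V} (hu : u ∈ C) :
    SetNC (localChordalize G u) C := by
  refine ⟨?_, ?_⟩
  · intro v hv a b w₁ w₂ h₁ h₂ hv1 hv2
    obtain ⟨w₁', h₁', hs1, he1⟩ := lc_hole (hC.1 u hu) h₁
    obtain ⟨w₂', h₂', hs2, he2⟩ := lc_hole (hC.1 u hu) h₂
    rw [← he1, ← he2]
    exact hC.1 v hv a b w₁' w₂' h₁' h₂' (hs1 ▸ hv1) (hs2 ▸ hv2)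
  · intro a w h v hv v' hv' h1 h2
    obtain ⟨w', h', hs, -⟩ := lc_hole (hC.1 u hu) h
    exact hC.2 a w' h' v hv v' hv' (hs ▸ h1) (hs ▸ h2)

lemma chordalize_adj (C : Set V) (l : List V) : ∀ (G : SimpleGraph V), SetNC G C →
    (∀ v ∈ l, v ∈ C) → ∀ a b, (chordalizeList G l).Adj a b →
      G.Adj a b ∨ (a ∈ C ∧ Hol G a b) ∨ (b ∈ C ∧ Hol G b a) := by
  induction l with
  | nil => intro G _ _ a b h; exact Or.inl h
  | cons u l ih =>
    intro G hC hl a b h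
    have huC : u ∈ C := hl u (by simp)
    have hhol : ∀ a b, Hol (localChordalize G u) a b → Hol G a b := by
      rintro a b ⟨c, w, hw, h1, h2⟩
      obtain ⟨w', h', hs, -⟩ := lc_hole (hC.1 u huC) hw
      exact ⟨c, w', h', hs ▸ h1, hs ▸ h2⟩
    rcases ih (localChordalize G u) (lc_setNC hC huC) (fun v hv => hl v (by simp [hv])) a b h with
      h | ⟨h1, h2⟩ | ⟨h1, h2⟩
    · rcases lc_adj.1 h with h | ⟨-, ⟨rfl, h⟩ | ⟨rfl, h⟩⟩
      · exact Or.inl h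
      · exact Or.inr (Or.inl ⟨huC, h⟩)
      · exact Or.inr (Or.inr ⟨huC, h⟩)
    · exact Or.inr (Or.inl ⟨h1, hhol _ _ h2⟩)
    · exact Or.inr (Or.inr ⟨h1, hhol _ _ h2⟩)

/-- All new edges inside the clique share one vertex. -/
lemma one_center (G : SimpleGraph V) (C : Set V) (hne : C.Nonempty) (hNC : SetNC G C) (K : Set V)
    (hK : ∀ a ∈ K, ∀ b ∈ K, a ≠ b → G.Adj a b ∨ (a ∈ C ∧ Hol G a b) ∨ (b ∈ C ∧ Hol G b a)) :
    ∃ u, ∀ a ∈ K, ∀ b ∈ K, a ≠ b → ¬ G.Adj a b → (a = u ∧ Hol G u b) ∨ (b = u ∧ Hol G u a) := by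
  have hsymm : ∀ a b, Hol G a b → Hol G b a := fun a b ⟨c, w, hw, h1, h2⟩ => ⟨c, w, hw, h2, h1⟩
  have hCC : ∀ a b, a ∈ C → b ∈ C → Hol G a b → a = b := fun a b ha hb ⟨c, w, hw, h1, h2⟩ =>
    hNC.2 c w hw a ha b hb h1 h2
  by_cases hnew : ∃ u ∈ K, ∃ x ∈ K, u ≠ x ∧ ¬ G.Adj u x ∧ u ∈ C ∧ Hol G u x
  · obtain ⟨u, huK, x, hxK, hux, hnux, huC, hHux⟩ := hnew
    have key : ∀ a ∈ K, ∀ b ∈ K, a ≠ b → ¬ G.Adj a b → a ∈ C → Hol G a b → a = u := by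
      intro a ha b hb hab hnab haC hHab
      by_contra hau
      have hua : G.Adj u a := by
        rcases hK u huK a ha (Ne.symm hau) with h | ⟨-, h⟩ | ⟨-, h⟩
        · exact h
        · exact absurd (hCC u a huC haC h).symm hau
        · exact absurd (hCC a u haC huC h) hau
      have hxC : x ∉ C := fun h => hux (hCC u x huC h hHux)
      have hbC : b ∉ C := fun h => hab (hCC a b haC h hHab)
      have hub : u ≠ b := by rintro rfl; exact hbC huC
      have hax : a ≠ x := by rintro rfl; exact hxC haC
      have hadj1 : G.Adj u b := by
        by_contra hn
        have h : Hol G u b := by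
          rcases hK u huK b hb hub with h | ⟨-, h⟩ | ⟨h, -⟩
          · exact absurd h hn
          · exact h
          · exact absurd h hbC
        exact hau (hCC u a huC haC (two_hole (hNC.1 u huC) (hNC.1 a haC) hua hub.symm hab.symm
          hn hnab h hHab)).symm
      have hadj2 : G.Adj a x := by
        by_contra hn
        have h : Hol G a x := by
          rcases hK a ha x hxK hax with h | ⟨-, h⟩ | ⟨h, -⟩
          · exact absurd h hn
          · exact h
          · exact absurd h hxC
        exact hau (hCC u a huC haC (two_hole (hNC.1 u huC) (hNC.1 a haC) hua hux.symm hax.symm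
          hnux hn hHux h)).symm
      have hxb : x ≠ b := by rintro rfl; exact hnux hadj1
      have hadj3 : G.Adj x b := by
        rcases hK x hxK b hb hxb with h | ⟨h, -⟩ | ⟨h, -⟩
        · exact h
        · exact absurd h hxC
        · exact absurd h hbC
      obtain ⟨w, hw, he, -, -, -⟩ := hole_maker (S := {a, x, b}) hua hadj1 hab hnab
        (by
          rintro (h | h | h)
          · exact hau h.symm
          · exact hux h
          · exact hub h)
        (by
          rintro v (h | h | h) hv
          · exact Or.inl h
          · rw [h] at hv; exact absurd hv hnux
          · exact Or.inr h)
        ((ConnIn.adj (by simp) (by simp) hadj2).trans (ConnIn.adj (by simp) (by simp) hadj3))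
      exact hau (hCC u a huC haC
        ⟨_, w, hw, w.start_mem_support, w.snd_mem_support_of_mem_edges he⟩).symm
    refine ⟨u, ?_⟩
    intro a ha b hb hab hnab
    rcases hK a ha b hb hab with h | ⟨h, h'⟩ | ⟨h, h'⟩
    · exact absurd h hnab
    · have := key a ha b hb hab hnab h h'
      exact Or.inl ⟨this, this ▸ h'⟩
    · have := key b hb a ha hab.symm (fun h => hnab h.symm) h h'
      exact Or.inr ⟨this, this ▸ h'⟩
  · obtain ⟨u, -⟩ := hne
    refine ⟨u, ?_⟩
    intro a ha b hb hab hnab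
    exfalso
    rcases hK a ha b hb hab with h | ⟨h, h'⟩ | ⟨h, h'⟩
    · exact hnab h
    · exact hnew ⟨a, ha, b, hb, hab, hnab, h, h'⟩
    · exact hnew ⟨b, hb, a, ha, hab.symm, fun h => hnab h.symm, h, h'⟩

/-- Branch sets: the centre `u` gets everything reachable from it outside the clique,
every other vertex is a singleton. -/
def branch (G : SimpleGraph V) (K : Set V) (u v : V) : Set V :=
  {z | (v = u ∧ ConnIn G {y | y ∈ K → y = u} u z) ∨ (v ≠ u ∧ z = v)}

lemma self_mem_branch (G : SimpleGraph V) (K : Set V) (u v : V) : v ∈ branch G K u v := by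
  by_cases h : v = u
  · subst h
    exact Or.inl ⟨rfl, ConnIn.refl fun _ => rfl⟩
  · exact Or.inr ⟨h, rfl⟩

lemma branch_nonempty (G : SimpleGraph V) (K : Set V) (u v : V) : (branch G K u v).Nonempty :=
  ⟨v, self_mem_branch G K u v⟩

lemma branch_connected (G : SimpleGraph V) (K : Set V) (u v : V) :
    (G.induce (branch G K u v)).Connected := by
  classical
  refine induce_connected_of_patches v (self_mem_branch G K u v) ?_
  rintro z (⟨rfl, p, hp⟩ | ⟨hv, rfl⟩)
  · refine ⟨{y | y ∈ p.support}, ?_, p.start_mem_support, p.end_mem_support,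
      p.connected_induce_support.preconnected _ _⟩
    intro y hy
    exact Or.inl ⟨rfl, p.takeUntil y hy, fun t ht =>
      hp t (p.support_takeUntil_subset_support hy ht)⟩
  · exact ⟨{z}, by rintro y rfl; exact self_mem_branch G K u y, rfl, rfl, Reachable.refl _⟩

lemma branch_disjoint (G : SimpleGraph V) (K : Set V) (u : V) {a b : V} (ha : a ∈ K) (hb : b ∈ K)
    (hab : a ≠ b) : Disjoint (branch G K u a) (branch G K u b) := by
  rw [Set.disjoint_left]
  rintro z (⟨rfl, h⟩ | ⟨h, rfl⟩) (⟨rfl, h'⟩ | ⟨h', rfl⟩)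
  · exact hab rfl
  · exact h' (h.right hb)
  · exact h (h'.right ha)
  · exact hab rfl

lemma branch_center (G : SimpleGraph V) (K : Set V) (u : V)
    (hu : ∀ a ∈ K, ∀ b ∈ K, a ≠ b → ¬ G.Adj a b → (a = u ∧ Hol G u b) ∨ (b = u ∧ Hol G u a))
    {b : V} (hb : b ∈ K) (hbu : b ≠ u) (hn : ¬ G.Adj u b) (h : Hol G u b) :
    ∃ c, ConnIn G {y | y ∈ K → y = u} u c ∧ G.Adj c b := by
  obtain ⟨a, w, hw, huw, hbw⟩ := h
  obtain ⟨m, x, H, hsup, -⟩ := exists_rep hw huw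
  obtain ⟨i, hi1, him, rfl⟩ := ((hsup b).1 hbw).resolve_left hbu
  have hm := H.hm
  have hne : ¬ (i = 1 ∨ i = m) := fun h => hn ((H.adju i hi1 him).2 h)
  have hcon : ∀ j, 1 ≤ j → j < m → G.Adj (x j) (x (j + 1)) := fun j h1 h2 =>
    (H.adj j (j + 1) h1 h2.le (by omega) (by omega)).2 (Or.inl rfl)
  have hcl : ∀ j k, 1 ≤ j → j < k → k ≤ m → x j ∈ K → x k ∈ K → k = j + 1 := by
    intro j k h1 h2 h3 hj hk
    by_contra hjk
    rcases hu _ hj _ hk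
      (fun h => by have := H.inj _ _ (by omega) (by omega) (by omega) (by omega) h; omega)
      (fun h => by
        have := (H.adj _ _ (by omega) (by omega) (by omega) (by omega)).1 h
        omega) with ⟨h, -⟩ | ⟨h, -⟩
    · exact H.ne _ (by omega) (by omega) h
    · exact H.ne _ (by omega) (by omega) h
  have huS : u ∈ {y | y ∈ K → y = u} := fun _ => rfl
  by_cases hK : x (i - 1) ∈ K
  · have hout : ∀ j, i + 1 ≤ j → j ≤ m → x j ∈ {y | y ∈ K → y = u} := by
      intro j h1 h2 hj
      have := hcl (i - 1) j (by omega) (by omega) h2 hK hj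
      omega
    refine ⟨x (i + 1), ?_, (hcon i hi1 (by omega)).symm⟩
    exact (ConnIn.adj huS (hout m (by omega) le_rfl)
      ((H.adju m (by omega) le_rfl).2 (Or.inr rfl))).trans
      (seg_conn (by omega) (fun j h1 h2 => hcon j (by omega) h2) hout).symm
  · have hout : ∀ j, 1 ≤ j → j ≤ i - 1 → x j ∈ {y | y ∈ K → y = u} := by
      intro j h1 h2 hj
      have := hcl j i h1 (by omega) him hj hb
      have h3 : i - 1 = j := by omega
      rw [h3] at hK
      exact absurd hj hK
    refine ⟨x (i - 1), ?_, ?_⟩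
    · exact (ConnIn.adj huS (hout 1 le_rfl (by omega))
        ((H.adju 1 le_rfl (by omega)).2 (Or.inl rfl))).trans
        (seg_conn (by omega) (fun j h1 h2 => hcon j h1 (by omega)) hout)
    · have := hcon (i - 1) (by omega) (by omega)
      rwa [Nat.sub_add_cancel hi1] at this

lemma branch_adj (G : SimpleGraph V) (K : Set V) (u : V)
    (hu : ∀ a ∈ K, ∀ b ∈ K, a ≠ b → ¬ G.Adj a b → (a = u ∧ Hol G u b) ∨ (b = u ∧ Hol G u a))
    {a b : V} (ha : a ∈ K) (hb : b ∈ K) (hab : a ≠ b) :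
    ∃ c ∈ branch G K u a, ∃ d ∈ branch G K u b, G.Adj c d := by
  by_cases h : G.Adj a b
  · exact ⟨a, self_mem_branch G K u a, b, self_mem_branch G K u b, h⟩
  rcases hu a ha b hb hab h with ⟨rfl, h'⟩ | ⟨rfl, h'⟩
  · obtain ⟨c, hc, hcb⟩ := branch_center G K a hu hb hab.symm h h'
    exact ⟨c, Or.inl ⟨rfl, hc⟩, b, self_mem_branch G K a b, hcb⟩
  · obtain ⟨c, hc, hcb⟩ := branch_center G K b hu ha hab (fun h1 => h h1.symm) h'
    exact ⟨a, self_mem_branch G K b a, c, Or.inl ⟨rfl, hc⟩, hcb.symm⟩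

/-- if `G` is `K_n`-minor-free then `Ĝ(C)` has no clique of size `n`. -/
theorem stmt10 {V : Type*} [Fintype V] [DecidableEq V] (G : SimpleGraph V) (C : Set V)
    (hcov : IsHoleCover G C) (hNC : SetNC G C)
    (l : List V) (hl : l.Nodup) (hlC : {v | v ∈ l} = C)
    (n : ℕ) (hfree : ¬ HasMinor G (⊤ : SimpleGraph (Fin n))) :
    (chordalizeList G l).CliqueFree n := by
  intro K hK
  apply hfree
  have hlC' : ∀ v ∈ l, v ∈ C := fun v hv => hlC ▸ hv
  obtain ⟨hKc, hKn⟩ := (SimpleGraph.isNClique_iff _).1 hK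
  obtain ⟨u, hu⟩ := one_center G C hcov.1 hNC (K : Set V) (fun a ha b hb hab =>
    chordalize_adj C l G hNC hlC' a b (hKc ha hb hab))
  let e := K.equivFinOfCardEq hKn
  have hsub : ∀ i j : Fin n, i ≠ j → ((e.symm i : K) : V) ≠ (e.symm j : K) := by
    intro i j hij h
    exact hij (e.symm.injective (Subtype.ext h))
  refine ⟨fun i => branch G K u (e.symm i : K), fun i => branch_nonempty _ _ _ _,
    fun i => branch_connected _ _ _ _, ?_, ?_⟩
  · intro i j hij
    exact branch_disjoint G _ u (e.symm i).2 (e.symm j).2 (hsub i j hij)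
  · intro i j hij
    exact branch_adj G _ u hu (e.symm i).2 (e.symm j).2 (hsub i j hij.ne)
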